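/- Let H₁ and H₂ be two disjoint well-linked sets in a graph G. Suppose A ⊆ H₁ is routable to B ⊆ H₂ and |A| ≤ |H₁|/2. Then for any A' ⊆ H₁ with |A'| ≤ |A|/2, the set A' is routable to B in G. -/

import Mathlib

open Finset

/-- Count of occurrences of `e` in a list (classical, no decidability assumptions). -/
noncomputable def ecount {α : Type} (l : List α) (e : α) : ℕ :=
  letI := Classical.decEq α
  l.count e

/-- The number of edges of `G` with exactly one endpoint in `S`, i.e. `|δ(S)|`. -/
noncomputable def edgeCut {V : Type} (G : SimpleGraph V) (S : Set V) : ℕ :=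
  {e ∈ G.edgeSet | ∃ u v, e = s(u, v) ∧ u ∈ S ∧ v ∉ S}.ncard

/-- `X` is (cut-)well-linked in `G`: `|δ(S)| ≥ |S ∩ X|` whenever `|S ∩ X| ≤ |X|/2`. -/
def WellLinked {V : Type} [DecidableEq V] (G : SimpleGraph V) (X : Finset V) : Prop :=
  ∀ S : Finset V, 2 * (S ∩ X).card ≤ X.card → (S ∩ X).card ≤ edgeCut G ↑S

/-- `S` is routable to `T` in `G`: there are `|S|` pairwise edge-disjoint paths from `S`
to `T` such that every vertex of `S ∪ T` is an endpoint of at most one of the paths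
(paths of length 0 are allowed). -/
def Routable {V : Type} (G : SimpleGraph V) (S T : Finset V) : Prop :=
  ∃ (f : V → V) (P : ∀ s ∈ S, G.Walk s (f s)),
    (∀ s ∈ S, f s ∈ T) ∧
    Set.InjOn f ↑S ∧
    (∀ s ∈ S, ∀ s' ∈ S, f s = s' → s = s') ∧
    ∀ e : Sym2 V, (∑ a ∈ S.attach, ecount (P a.1 a.2).edges e) ≤ 1

/-- The maximum number of pairwise edge-disjoint paths from `A` to `B` in `G` (with
every vertex of `A ∪ B` the endpoint of at most one path). -/
noncomputable def maxEDPaths {V : Type} (G : SimpleGraph V) (A B : Finset V) : ℕ :=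
  sSup {r : ℕ | ∃ A' ⊆ A, A'.card = r ∧ Routable G A' B}

theorem edgeCut_compl {V : Type} (G : SimpleGraph V) (S : Set V) : edgeCut G Sᶜ = edgeCut G S := by
  unfold edgeCut
  congr 1
  ext e
  constructor <;> rintro ⟨he, u, v, rfl, hu, hv⟩ <;>
    exact ⟨he, v, u, Sym2.eq_swap, by simpa using hv, by simpa using hu⟩

section Menger

variable {V : Type} [Fintype V]

open Classical in
/-- The indicator of the ordered adjacent pairs leaving `S`. -/
noncomputable def leavingIndicator {V : Type} (G : SimpleGraph V) (S : Finset V) (q : V × V) : ℤ :=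
  if G.Adj q.1 q.2 ∧ q.1 ∈ S ∧ q.2 ∉ S then 1 else 0

/-- The number of ordered adjacent pairs leaving `S`. -/
noncomputable def outDegree (G : SimpleGraph V) (S : Finset V) : ℤ :=
  ∑ q : V × V, leavingIndicator G S q

theorem outDegree_eq_edgeCut (G : SimpleGraph V) (S : Finset V) :
    outDegree G S = edgeCut G ↑S := by
  classical
  unfold outDegree leavingIndicator edgeCut
  rw [Finset.sum_boole]
  norm_cast
  rw [← Set.ncard_coe_finset]
  refine Set.ncard_congr (fun q _ => s(q.1, q.2)) ?_ ?_ ?_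
  · rintro ⟨x, y⟩ h
    simp only [coe_filter, mem_univ, true_and, Set.mem_ofPred_eq] at h
    exact ⟨h.1, x, y, rfl, h.2.1, h.2.2⟩
  · rintro ⟨x, y⟩ ⟨x', y'⟩ h h' heq
    simp only [coe_filter, mem_univ, true_and, Set.mem_ofPred_eq] at h h'
    rcases Sym2.eq_iff.1 heq with ⟨rfl, rfl⟩ | ⟨rfl, rfl⟩
    · rfl
    · exact absurd h.2.1 h'.2.2
  · rintro e ⟨he, x, y, rfl, hx, hy⟩
    exact ⟨(x, y), by simpa using ⟨he, hx, hy⟩, rfl⟩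

theorem outDegree_inter_add_outDegree_union_le [DecidableEq V] (G : SimpleGraph V)
    (S T : Finset V) :
    outDegree G (S ∩ T) + outDegree G (S ∪ T) ≤ outDegree G S + outDegree G T := by
  unfold outDegree
  rw [← Finset.sum_add_distrib, ← Finset.sum_add_distrib]
  refine Finset.sum_le_sum fun q _ => ?_
  by_cases h : G.Adj q.1 q.2 <;> by_cases h1 : q.1 ∈ S <;> by_cases h2 : q.2 ∈ S <;>
    by_cases h3 : q.1 ∈ T <;> by_cases h4 : q.2 ∈ T <;>
    simp [leavingIndicator, h, h1, h2, h3, h4]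

theorem outDegree_deleteEdge_of_iff (G : SimpleGraph V) {u v : V} {S : Finset V}
    (h : u ∈ S ↔ v ∈ S) : outDegree (G.deleteEdges {s(u, v)}) S = outDegree G S := by
  unfold outDegree
  refine Finset.sum_congr rfl fun q _ => ?_
  unfold leavingIndicator
  congr 1
  simp only [SimpleGraph.deleteEdges_adj, Set.mem_singleton_iff, Sym2.eq_iff, eq_iff_iff]
  constructor
  · tauto
  · rintro ⟨hadj, hq, hq'⟩
    refine ⟨⟨hadj, ?_⟩, hq, hq'⟩
    rintro (⟨h1, h2⟩ | ⟨h1, h2⟩) <;> rw [h1] at hq <;> rw [h2] at hq' <;> tauto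

theorem outDegree_deleteEdge_of_mem_of_notMem (G : SimpleGraph V) {u v : V} (huv : G.Adj u v)
    {S : Finset V} (hu : u ∈ S) (hv : v ∉ S) :
    outDegree (G.deleteEdges {s(u, v)}) S = outDegree G S - 1 := by
  classical
  unfold outDegree
  rw [← Finset.add_sum_erase univ _ (mem_univ (u, v)),
    ← Finset.add_sum_erase univ (leavingIndicator G S) (mem_univ (u, v))]
  have hrest : ∀ q ∈ univ.erase (u, v),
      leavingIndicator (G.deleteEdges {s(u, v)}) S q = leavingIndicator G S q := by
    rintro ⟨x, y⟩ hq
    unfold leavingIndicator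
    congr 1
    simp only [SimpleGraph.deleteEdges_adj, Set.mem_singleton_iff, Sym2.eq_iff, eq_iff_iff]
    simp only [Finset.mem_erase, ne_eq, Prod.mk.injEq] at hq
    constructor
    · tauto
    · rintro ⟨hadj, hq1, hq2⟩
      refine ⟨⟨hadj, ?_⟩, hq1, hq2⟩
      rintro (h | ⟨rfl, rfl⟩)
      · exact hq.1 h
      · exact hv hq1
  have hdel : leavingIndicator (G.deleteEdges {s(u, v)}) S (u, v) = 0 := by
    simp [leavingIndicator]
  have hG : leavingIndicator G S (u, v) = 1 := by
    simp [leavingIndicator, huv, hu, hv]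
  rw [Finset.sum_congr rfl hrest, hdel, hG]
  ring

theorem outDegree_deleteEdge_of_notMem_of_mem (G : SimpleGraph V) {u v : V} (huv : G.Adj u v)
    {S : Finset V} (hu : u ∉ S) (hv : v ∈ S) :
    outDegree (G.deleteEdges {s(u, v)}) S = outDegree G S - 1 := by
  rw [Sym2.eq_swap]
  exact outDegree_deleteEdge_of_mem_of_notMem G huv.symm hv hu

theorem outDegree_insert_le [DecidableEq V] (G : SimpleGraph V) {u : V} {T : Finset V}
    (h : ∀ v, G.Adj u v → v ∈ T) : outDegree G (insert u T) ≤ outDegree G T := by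
  unfold outDegree
  refine Finset.sum_le_sum fun q _ => ?_
  unfold leavingIndicator
  split_ifs with h1 h2
  · rfl
  · exfalso
    obtain ⟨hadj, hq, hq'⟩ := h1
    rw [Finset.mem_insert] at hq hq'
    rcases hq with hq | hq
    · exact hq' (Or.inr (h _ (hq ▸ hadj)))
    · exact h2 ⟨hadj, hq, fun h' => hq' (Or.inr h')⟩
  · exact zero_le_one
  · rfl

/-- If the supply `w` satisfies the cut condition, then an edge at a vertex `u` of positive
supply can either be deleted, or used to move a unit of supply along it, without destroying the
cut condition. -/
theorem exists_adj_cut_condition [DecidableEq V] (G : SimpleGraph V) (w : V → ℤ)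
    (hw : ∀ S : Finset V, ∑ x ∈ S, w x ≤ outDegree G S) {u : V} (hu : 0 < w u) :
    ∃ v, G.Adj u v ∧
      ((∀ S : Finset V, ∑ x ∈ S, w x ≤ outDegree (G.deleteEdges {s(u, v)}) S) ∨
        ∀ S : Finset V, ∑ x ∈ S, (w x - (if x = u then 1 else 0) + (if x = v then 1 else 0)) ≤
          outDegree (G.deleteEdges {s(u, v)}) S) := by
  obtain ⟨T, hT, hmax⟩ := Finset.exists_max_image
    (univ.filter fun T : Finset V => u ∉ T ∧ ∑ x ∈ T, w x = outDegree G T) Finset.card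
    ⟨∅, by simp [outDegree, leavingIndicator]⟩
  simp only [mem_filter, mem_univ, true_and] at hT hmax
  obtain ⟨huT, hTtight⟩ := hT
  obtain ⟨v, huv, hvT⟩ : ∃ v, G.Adj u v ∧ v ∉ T := by
    by_contra! hcon
    have h1 := outDegree_insert_le G hcon
    have h2 := hw (insert u T)
    rw [Finset.sum_insert huT] at h2
    linarith
  have hnot : ∀ X : Finset V, v ∈ X → u ∉ X → ∑ x ∈ X, w x ≠ outDegree G X := by
    intro X hvX huX hX
    have h1 := outDegree_inter_add_outDegree_union_le G T X
    have h2 := Finset.sum_union_inter (s₁ := T) (s₂ := X) (f := w)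
    have h3 := hw (T ∩ X)
    have h4 := hw (T ∪ X)
    have h5 := hmax (T ∪ X) ⟨by simp [huT, huX], by linarith⟩
    have h6 : T ⊂ T ∪ X := by
      refine Finset.ssubset_iff_of_subset Finset.subset_union_left |>.2 ⟨v, by simp [hvX], hvT⟩
    exact absurd (Finset.card_lt_card h6) (by omega)
  refine ⟨v, huv, ?_⟩
  by_cases hdel : ∀ S : Finset V, ∑ x ∈ S, w x ≤ outDegree (G.deleteEdges {s(u, v)}) S
  · exact Or.inl hdel
  right
  push Not at hdel
  obtain ⟨S, hS⟩ := hdel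
  have hSw := hw S
  obtain ⟨huS, hvS⟩ : u ∈ S ∧ v ∉ S := by
    by_cases h1 : u ∈ S <;> by_cases h2 : v ∈ S
    · rw [outDegree_deleteEdge_of_iff G (by tauto)] at hS
      omega
    · exact ⟨h1, h2⟩
    · rw [outDegree_deleteEdge_of_notMem_of_mem G huv h1 h2] at hS
      exact absurd (by omega) (hnot S h2 h1)
    · rw [outDegree_deleteEdge_of_iff G (by tauto)] at hS
      omega
  intro X
  have hXw := hw X
  rw [Finset.sum_add_distrib, Finset.sum_sub_distrib, Finset.sum_ite_eq', Finset.sum_ite_eq']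
  by_cases h1 : u ∈ X <;> by_cases h2 : v ∈ X
  · rw [outDegree_deleteEdge_of_iff G (by tauto)]
    simp [h1, h2, hXw]
  · rw [outDegree_deleteEdge_of_mem_of_notMem G huv h1 h2]
    simp [h1, h2, hXw]
  · have e1 := outDegree_inter_add_outDegree_union_le (G.deleteEdges {s(u, v)}) S X
    have e2 := Finset.sum_union_inter (s₁ := S) (s₂ := X) (f := w)
    have e3 := hw (S ∩ X)
    have e4 := hw (S ∪ X)
    rw [outDegree_deleteEdge_of_iff G (S := S ∩ X) (by simp [h1, hvS]),
      outDegree_deleteEdge_of_iff G (S := S ∪ X) (by simp [huS, h2]),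
      outDegree_deleteEdge_of_mem_of_notMem G huv huS hvS] at e1
    rw [outDegree_deleteEdge_of_mem_of_notMem G huv huS hvS] at hS
    rw [outDegree_deleteEdge_of_notMem_of_mem G huv h1 h2] at e1 ⊢
    simp only [h1, h2, if_true, if_false]
    linarith
  · rw [outDegree_deleteEdge_of_iff G (by tauto)]
    simp [h1, h2, hXw]

theorem ecount_eq_count {α : Type} [DecidableEq α] (l : List α) (e : α) :
    ecount l e = l.count e := by
  unfold ecount
  congr!

theorem ecount_cons {α : Type} [DecidableEq α] (e e' : α) (l : List α) :
    ecount (e' :: l) e = ecount l e + if e' = e then 1 else 0 := by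
  simp [ecount_eq_count, List.count_cons]

/-- The edge version of Menger's theorem for starting points `p i`, `i ∈ I`, and distinct
end points in `B`. -/
theorem exists_edgeDisjoint_walks [DecidableEq V] {ι : Type} [DecidableEq ι] (n : ℕ) :
    ∀ (G : SimpleGraph V) (I : Finset ι) (p : ι → V) (B : Finset V),
      G.edgeSet.ncard + I.card = n →
      (∀ S : Finset V, ∑ x ∈ S, (((I.filter fun i => p i = x).card : ℤ) -
        if x ∈ B then 1 else 0) ≤ outDegree G S) →
      ∃ (f : ι → V) (L : ι → List (Sym2 V)),
        (∀ i ∈ I, f i ∈ B ∧ ∃ P : G.Walk (p i) (f i), P.edges = L i) ∧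
        Set.InjOn f ↑I ∧ ∀ e, ∑ i ∈ I, ecount (L i) e ≤ 1 := by
  induction n using Nat.strong_induction_on with
  | _ n ih =>
    intro G I p B hn hcut
    rcases I.eq_empty_or_nonempty with rfl | ⟨i, hi⟩
    · exact ⟨p, fun _ => [], by simp, by simp, by simp⟩
    by_cases hpB : p i ∈ B
    · obtain ⟨f, L, hf, hinj, hL⟩ := ih (G.edgeSet.ncard + (I.erase i).card)
        (by have := Finset.card_erase_lt_of_mem hi; omega) G (I.erase i) p (B.erase (p i)) rfl
        (by
          intro S
          convert hcut S using 2 with x hx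
          rw [Finset.filter_erase]
          by_cases hx : p i = x
          · subst hx
            have hmem : i ∈ I.filter fun j => p j = p i := by simp [hi]
            have := Finset.card_erase_add_one hmem
            simp only [Finset.mem_erase, ne_eq, not_true_eq_false, false_and, if_false, hpB,
              if_true]
            omega
          · rw [Finset.erase_eq_of_notMem (by simp [hx])]
            simp [Finset.mem_erase, Ne.symm hx])
      have hne : ∀ j ∈ I.erase i, j ≠ i := fun j hj => Finset.ne_of_mem_erase hj
      refine ⟨Function.update f i (p i), Function.update L i [], ?_, ?_, ?_⟩
      · intro j hj
        by_cases hji : j = i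
        · subst hji
          rw [Function.update_self, Function.update_self]
          exact ⟨hpB, .nil, rfl⟩
        · rw [Function.update_of_ne hji, Function.update_of_ne hji]
          have := hf j (Finset.mem_erase.2 ⟨hji, hj⟩)
          exact ⟨Finset.mem_of_mem_erase this.1, this.2⟩
      · intro j hj k hk hjk
        by_cases hji : j = i <;> by_cases hki : k = i
        · rw [hji, hki]
        · subst hji
          rw [Function.update_self, Function.update_of_ne hki] at hjk
          exact absurd hjk.symm (Finset.ne_of_mem_erase (hf k (Finset.mem_erase.2 ⟨hki, hk⟩)).1)
        · subst hki
          rw [Function.update_self, Function.update_of_ne hji] at hjk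
          exact absurd hjk (Finset.ne_of_mem_erase (hf j (Finset.mem_erase.2 ⟨hji, hj⟩)).1)
        · rw [Function.update_of_ne hji, Function.update_of_ne hki] at hjk
          exact hinj (Finset.mem_coe.2 (Finset.mem_erase.2 ⟨hji, hj⟩))
            (Finset.mem_coe.2 (Finset.mem_erase.2 ⟨hki, hk⟩)) hjk
      · intro e
        rw [← Finset.add_sum_erase I _ hi, Function.update_self,
          Finset.sum_congr rfl fun j hj => by rw [Function.update_of_ne (hne j hj)]]
        simpa [ecount] using hL e
    · obtain ⟨v, huv, hv⟩ := exists_adj_cut_condition G _ hcut (u := p i) (by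
        have : 0 < (I.filter fun j => p j = p i).card :=
          Finset.card_pos.2 ⟨i, by simp [hi]⟩
        simp only [hpB, if_false]
        omega)
      have hlt : (G.deleteEdges {s(p i, v)}).edgeSet.ncard < G.edgeSet.ncard := by
        refine Set.ncard_lt_ncard ?_ (Set.toFinite _)
        rw [SimpleGraph.edgeSet_deleteEdges]
        exact ⟨Set.sdiff_subset, fun h => (h (show s(p i, v) ∈ G.edgeSet from huv)).2 rfl⟩
      have hle : G.deleteEdges {s(p i, v)} ≤ G := SimpleGraph.deleteEdges_le _
      rcases hv with hv | hv
      · obtain ⟨f, L, hf, hinj, hL⟩ := ih _ (by omega)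
          (G.deleteEdges {s(p i, v)}) I p B rfl hv
        refine ⟨f, L, fun j hj => ⟨(hf j hj).1, ?_⟩, hinj, hL⟩
        obtain ⟨P, hP⟩ := (hf j hj).2
        exact ⟨P.mapLe hle, by simpa using hP⟩
      · obtain ⟨f, L, hf, hinj, hL⟩ := ih _ (by omega)
          (G.deleteEdges {s(p i, v)}) I (Function.update p i v) B rfl (by
          intro S
          convert hv S using 2 with x hx
          have hcard : ∀ q : ι → V, ((I.filter fun j => q j = x).card : ℤ) =
              (if q i = x then 1 else 0) + ((I.erase i).filter fun j => q j = x).card := by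
            intro q
            rw [Finset.card_filter, Finset.card_filter, ← Finset.add_sum_erase I _ hi]
            push_cast
            rfl
          rw [hcard, hcard p, Finset.filter_congr (p := fun j => Function.update p i v j = x)
            (q := fun j => p j = x)
            (fun j hj => by rw [Function.update_of_ne (Finset.ne_of_mem_erase hj)]),
            Function.update_self]
          simp only [eq_comm (a := x)]
          ring)
        have hnotMem : ∀ j ∈ I, s(p i, v) ∉ L j := by
          intro j hj hmem
          obtain ⟨P, hP⟩ := (hf j hj).2
          rw [← hP] at hmem
          have := P.edges_subset_edgeSet hmem
          simp at this
        refine ⟨f, Function.update L i (s(p i, v) :: L i), ?_, hinj, ?_⟩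
        · intro j hj
          refine ⟨(hf j hj).1, ?_⟩
          obtain ⟨P, hP⟩ := (hf j hj).2
          by_cases hji : j = i
          · subst hji
            rw [Function.update_self]
            refine ⟨.cons huv ((P.mapLe hle).copy (Function.update_self ..) rfl), ?_⟩
            simpa using hP
          · rw [Function.update_of_ne hji]
            exact ⟨(P.mapLe hle).copy (Function.update_of_ne hji ..) rfl, by simpa using hP⟩
        · intro e
          rw [← Finset.add_sum_erase I _ hi, Function.update_self,
            Finset.sum_congr rfl fun j hj => by
              rw [Function.update_of_ne (Finset.ne_of_mem_erase hj)],
            ecount_cons, add_right_comm, Finset.add_sum_erase I (fun j => ecount (L j) e) hi]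
          by_cases he : s(p i, v) = e
          · subst he
            rw [Finset.sum_eq_zero fun j hj => ?_]
            · simp
            · rw [ecount_eq_count]
              exact List.count_eq_zero.2 (hnotMem j hj)
          · simpa [he] using hL e

/-- The cut condition suffices for routing between disjoint sets. -/
theorem routable_of_cut_condition [DecidableEq V] (G : SimpleGraph V) {A B : Finset V}
    (hAB : Disjoint A B)
    (hcut : ∀ S : Finset V, (S ∩ A).card ≤ edgeCut G ↑S + (S ∩ B).card) : Routable G A B := by
  obtain ⟨f, L, hf, hinj, hL⟩ := exists_edgeDisjoint_walks _ G A id B rfl (by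
    intro S
    rw [outDegree_eq_edgeCut, Finset.sum_sub_distrib, Finset.sum_boole, Finset.filter_mem_eq_inter]
    have h : ∀ x ∈ S, ((A.filter fun i => id i = x).card : ℤ) = if x ∈ A then 1 else 0 := by
      intro x _
      simp only [id, Finset.filter_eq']
      split_ifs <;> simp
    rw [Finset.sum_congr rfl h, Finset.sum_boole, Finset.filter_mem_eq_inter]
    have := hcut S
    omega)
  choose hB P hP using hf
  refine ⟨f, P, hB, hinj, ?_, ?_⟩
  · rintro s hs _ hs' rfl
    exact absurd (hB s hs) (Finset.disjoint_left.1 hAB hs')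
  · intro e
    simp only [hP]
    rw [Finset.sum_attach A fun a => ecount (L a) e]
    exact hL e

/-- Routability implies the cut condition. -/
theorem Routable.cut_condition [DecidableEq V] {G : SimpleGraph V} {A B : Finset V}
    (h : Routable G A B) (S : Finset V) : (S ∩ A).card ≤ edgeCut G ↑S + (S ∩ B).card := by
  obtain ⟨f, P, hB, hinj, -, hP⟩ := h
  have hcross : ∀ a : A, ∃ e : Sym2 V, a.1 ∈ S → f a ∉ S → e ∈ (P a.1 a.2).edges ∧
      ∃ u v, e = s(u, v) ∧ u ∈ (S : Set V) ∧ v ∉ (S : Set V) := by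
    intro a
    by_cases h : a.1 ∈ S ∧ f a ∉ S
    swap
    · exact ⟨s(a.1, a.1), fun h1 h2 => absurd ⟨h1, h2⟩ h⟩
    obtain ⟨ha, hfa⟩ := h
    obtain ⟨d, hd, h1, h2⟩ := (P a.1 a.2).exists_boundary_dart (S : Set V) ha hfa
    exact ⟨d.edge, fun _ _ => ⟨List.mem_map_of_mem hd, d.fst, d.snd, rfl, h1, h2⟩⟩
  choose g hg using hcross
  have hsub : (A.attach.filter fun a : A => a.1 ∈ S ∧ f a.1 ∉ S).card ≤ edgeCut G ↑S := by
    rw [← Set.ncard_coe_finset]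
    refine Set.ncard_le_ncard_of_injOn g ?_ ?_ (Set.toFinite _)
    · intro a ha
      simp only [coe_filter, Set.mem_ofPred_eq] at ha
      exact ⟨(P a.1 a.2).edges_subset_edgeSet (hg a ha.2.1 ha.2.2).1, (hg a ha.2.1 ha.2.2).2⟩
    · intro a ha b hb hab
      simp only [coe_filter, Set.mem_ofPred_eq] at ha hb
      by_contra hne
      have hpos : ∀ c : A, g a ∈ (P c.1 c.2).edges → 1 ≤ ecount (P c.1 c.2).edges (g a) :=
        fun c hc => by
          rw [ecount_eq_count]
          exact List.one_le_count_iff.2 hc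
      have h1 := hpos a (hg a ha.2.1 ha.2.2).1
      have h2 := hpos b (hab ▸ (hg b hb.2.1 hb.2.2).1)
      have h3 := hP (g a)
      have h4 := Finset.sum_le_sum_of_subset (f := fun c : A => ecount (P c.1 c.2).edges (g a))
        (show ({a, b} : Finset A) ⊆ A.attach from fun _ _ => Finset.mem_attach _ _)
      rw [Finset.sum_pair hne] at h4
      omega
  have hin : (A.filter fun a => a ∈ S ∧ f a ∈ S).card ≤ (S ∩ B).card := by
    refine Finset.card_le_card_of_injOn f ?_ (hinj.mono ?_)
    · intro a ha
      simp only [coe_filter, Set.mem_ofPred_eq] at ha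
      simpa using ⟨ha.2.2, hB a ha.1⟩
    · intro a ha
      simp only [coe_filter, Set.mem_ofPred_eq] at ha
      exact ha.1
  have hout : (A.filter fun a => a ∈ S ∧ f a ∉ S).card ≤ edgeCut G ↑S := by
    refine le_trans ?_ hsub
    refine Finset.card_le_card_of_surjOn Subtype.val ?_
    intro a ha
    simp only [coe_filter, Set.mem_ofPred_eq] at ha
    exact ⟨⟨a, ha.1⟩, by simpa using ha.2, rfl⟩
  have hsplit : (S ∩ A).card = (A.filter fun a => a ∈ S ∧ f a ∈ S).card +
      (A.filter fun a => a ∈ S ∧ f a ∉ S).card := by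
    rw [← Finset.filter_filter, ← Finset.filter_filter,
      Finset.card_filter_add_card_filter_not, Finset.filter_mem_eq_inter, Finset.inter_comm]
  omega

end Menger

/-- **Rerouting between two well-linked sets (Lemma `lem:alltoall1`).** Let `H₁` and
`H₂` be two disjoint well-linked sets in `G`. Suppose `A ⊆ H₁` is routable to
`B ⊆ H₂` and `|A| ≤ |H₁|/2`. Then any `A' ⊆ H₁` with `|A'| ≤ |A|/2` is routable to
`B` in `G`. -/
theorem reroute_half
    (V : Type) [Fintype V] [DecidableEq V] (G : SimpleGraph V)
    (H₁ H₂ : Finset V) (hdisj : Disjoint H₁ H₂)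
    (h1 : WellLinked G H₁) (h2 : WellLinked G H₂)
    (A : Finset V) (hA : A ⊆ H₁) (B : Finset V) (hB : B ⊆ H₂)
    (hAB : Routable G A B) (hAhalf : 2 * A.card ≤ H₁.card)
    (A' : Finset V) (hA' : A' ⊆ H₁) (hA'half : 2 * A'.card ≤ A.card) :
    Routable G A' B := by
  refine routable_of_cut_condition G (hdisj.mono hA' hB) fun S => ?_
  have hS : (S ∩ A').card ≤ (S ∩ H₁).card :=
    Finset.card_le_card (Finset.inter_subset_inter_left hA')
  rcases le_total (2 * (S ∩ H₁).card) H₁.card with hle | hle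
  · have := h1 S hle
    omega
  · have hsplit : ∀ X : Finset V, (S ∩ X).card + (Sᶜ ∩ X).card = X.card := by
      intro X
      rw [Finset.inter_comm S, Finset.inter_comm Sᶜ, ← Finset.sdiff_eq_inter_compl,
        Finset.card_inter_add_card_sdiff]
    have hsplitH := hsplit H₁
    have hsplitA := hsplit A
    have hcompl := h1 Sᶜ (by omega)
    rw [Finset.coe_compl, edgeCut_compl] at hcompl
    have hAle : (Sᶜ ∩ A).card ≤ (Sᶜ ∩ H₁).card :=
      Finset.card_le_card (Finset.inter_subset_inter_left hA)
    have hroute := hAB.cut_condition S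
    have hA'card : (S ∩ A').card ≤ A'.card := Finset.card_le_card Finset.inter_subset_right
    omega
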